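/- For any affine function p on a simplex τ with vertex values p_i, i = 0,…,d, it holds that |τ|/((d+1)(d+2)) · Σ_i p_i² ≤ ∫_τ p(x)² dx ≤ |τ|/(d+1) · Σ_i p_i². -/

import Mathlib

open MeasureTheory

namespace SimplexAux

variable {d : ℕ}

/-- Affine map onto the half simplex obtained by bisecting the edge between vertices `i`, `j`. -/
noncomputable def T (b : AffineBasis (Fin (d + 1)) ℝ (Fin d → ℝ)) (i j : Fin (d + 1))
    (x : Fin d → ℝ) : Fin d → ℝ := x + b.coord j x • ((1 / 2 : ℝ) • (b i - b j))

lemma coord_add (b : AffineBasis (Fin (d + 1)) ℝ (Fin d → ℝ)) (i j k : Fin (d + 1)) (c : ℝ)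
    (x : Fin d → ℝ) : b.coord k (x + c • (b i - b j)) =
      b.coord k x + c * (b.coord k (b i) - b.coord k (b j)) := by
  have h := (b.coord k).map_vadd x (c • (b i - b j))
  rw [vadd_eq_add, vadd_eq_add, add_comm (c • (b i - b j)) x] at h
  rw [h, map_smul, ← vsub_eq_sub (b i), AffineMap.linearMap_vsub, vsub_eq_sub, smul_eq_mul,
    add_comm]

lemma coord_T (b : AffineBasis (Fin (d + 1)) ℝ (Fin d → ℝ)) (i j k : Fin (d + 1))
    (x : Fin d → ℝ) : b.coord k (T b i j x) =
      b.coord k x + b.coord j x / 2 * (b.coord k (b i) - b.coord k (b j)) := by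
  rw [T, smul_smul, coord_add]; ring

lemma coord_T_left (b : AffineBasis (Fin (d + 1)) ℝ (Fin d → ℝ)) {i j : Fin (d + 1)}
    (h : i ≠ j) (x : Fin d → ℝ) : b.coord i (T b i j x) = b.coord i x + b.coord j x / 2 := by
  rw [coord_T, b.coord_apply_eq, b.coord_apply_ne h]; ring

lemma coord_T_right (b : AffineBasis (Fin (d + 1)) ℝ (Fin d → ℝ)) {i j : Fin (d + 1)}
    (h : i ≠ j) (x : Fin d → ℝ) : b.coord j (T b i j x) = b.coord j x / 2 := by
  rw [coord_T, b.coord_apply_eq, b.coord_apply_ne h.symm]; ring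

/-- The simplex. -/
def S (b : AffineBasis (Fin (d + 1)) ℝ (Fin d → ℝ)) : Set (Fin d → ℝ) :=
  {x | ∀ i, 0 ≤ b.coord i x}

lemma S_eq (b : AffineBasis (Fin (d + 1)) ℝ (Fin d → ℝ)) :
    S b = convexHull ℝ (Set.range b) := (b.convexHull_eq_nonneg_coord).symm

lemma compact_S (b : AffineBasis (Fin (d + 1)) ℝ (Fin d → ℝ)) : IsCompact (S b) := by
  rw [S_eq]; exact (Set.finite_range _).isCompact_convexHull ℝ

lemma cont_coord (b : AffineBasis (Fin (d + 1)) ℝ (Fin d → ℝ)) (i : Fin (d + 1)) :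
    Continuous (b.coord i) := (b.coord i).continuous_of_finiteDimensional

lemma T_image_subset (b : AffineBasis (Fin (d + 1)) ℝ (Fin d → ℝ)) {i j : Fin (d + 1)}
    (h : i ≠ j) : T b i j '' S b ⊆ S b := by
  rintro _ ⟨x, hx, rfl⟩ k
  have hk := hx k
  have hj := hx j
  by_cases h1 : k = i
  · subst h1; rw [coord_T_left b h]; linarith
  by_cases h2 : k = j
  · subst h2; rw [coord_T_right b h]; linarith
  rw [coord_T, b.coord_apply_ne h1, b.coord_apply_ne h2]; linarith

lemma subset_T_image (b : AffineBasis (Fin (d + 1)) ℝ (Fin d → ℝ)) {i j : Fin (d + 1)}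
    (h : i ≠ j) {x : Fin d → ℝ} (hx : x ∈ S b) (hij : b.coord j x ≤ b.coord i x) :
    x ∈ T b i j '' S b := by
  have hj : b.coord j (x + b.coord j x • (b j - b i)) = 2 * b.coord j x := by
    rw [coord_add, b.coord_apply_eq, b.coord_apply_ne h.symm]; ring
  refine ⟨x + b.coord j x • (b j - b i), fun k => ?_, ?_⟩
  · have hk := hx k
    by_cases h1 : k = i
    · subst h1; rw [coord_add, b.coord_apply_eq, b.coord_apply_ne h]; linarith
    by_cases h2 : k = j
    · subst h2; rw [hj]; linarith
    rw [coord_add, b.coord_apply_ne h1, b.coord_apply_ne h2]; linarith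
  · rw [T, hj]; module

lemma T_inj (b : AffineBasis (Fin (d + 1)) ℝ (Fin d → ℝ)) {i j : Fin (d + 1)}
    (h : i ≠ j) : Function.Injective (T b i j) := by
  intro x y hxy
  have := congrArg (b.coord j) hxy
  rw [coord_T_right b h, coord_T_right b h] at this
  have h2 : b.coord j x = b.coord j y := by linarith
  simpa [T, h2] using hxy

lemma T_integral (b : AffineBasis (Fin (d + 1)) ℝ (Fin d → ℝ)) {i j : Fin (d + 1)}
    (h : i ≠ j) (f : (Fin d → ℝ) → ℝ) :
    ∫ x in T b i j '' S b, f x = (1 / 2) * ∫ x in S b, f (T b i j x) := by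
  let L : (Fin d → ℝ) →L[ℝ] (Fin d → ℝ) := LinearMap.toContinuousLinearMap
    (LinearMap.transvection (b.coord j).linear ((1 / 2 : ℝ) • (b i - b j)))
  have hdet : L.det = 1 / 2 := by
    have : L.det = LinearMap.det
      (LinearMap.transvection (b.coord j).linear ((1 / 2 : ℝ) • (b i - b j))) := rfl
    rw [this, LinearMap.transvection.det, map_smul, ← vsub_eq_sub (b i), AffineMap.linearMap_vsub,
      b.coord_apply_eq, b.coord_apply_ne h.symm]
    norm_num
  have hT : ∀ x, T b i j x = L x + T b i j 0 := by
    intro x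
    have h0 : b.coord j x = (b.coord j).linear x + b.coord j 0 := by
      have := (b.coord j).map_vadd 0 x
      simpa using this
    have hL : L x = x + (b.coord j).linear x • ((1 / 2 : ℝ) • (b i - b j)) := rfl
    rw [hL, T, T, h0]; module
  have hd : ∀ x ∈ S b, HasFDerivWithinAt (T b i j) L (S b) x := by
    intro x _
    rw [show T b i j = fun x => L x + T b i j 0 from funext hT]
    exact (L.hasFDerivAt.add_const _).hasFDerivWithinAt
  rw [integral_image_eq_integral_abs_det_fderiv_smul volume (compact_S b).measurableSet hd
    (T_inj b h).injOn f, hdet]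
  simp only [smul_eq_mul]
  rw [integral_const_mul]; norm_num

lemma key (b : AffineBasis (Fin (d + 1)) ℝ (Fin d → ℝ)) {i j : Fin (d + 1)}
    (h : i ≠ j) (f : (Fin d → ℝ) → ℝ) (hf : Continuous f) (h0 : ∀ x ∈ S b, 0 ≤ f x) :
    ∫ x in S b, f x ≤ (1 / 2) * (∫ x in S b, f (T b i j x)) +
      (1 / 2) * ∫ x in S b, f (T b j i x) := by
  rw [← T_integral b h, ← T_integral b h.symm]
  have hT : ∀ i j, Continuous (T b i j) := fun i j => by
    have := cont_coord b j
    unfold T; fun_prop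
  have hm : ∀ i j, MeasurableSet (T b i j '' S b) := fun i j =>
    ((compact_S b).image (hT i j)).measurableSet
  have hi : ∀ i j, IntegrableOn f (T b i j '' S b) := fun i j =>
    hf.continuousOn.integrableOn_compact ((compact_S b).image (hT i j))
  have hU : MeasurableSet {x | b.coord j x ≤ b.coord i x} :=
    (isClosed_le (cont_coord b j) (cont_coord b i)).measurableSet
  rw [← integral_inter_add_sdiff hU (hf.continuousOn.integrableOn_compact (compact_S b))]
  refine add_le_add (setIntegral_mono_set (hi i j) ?_ ?_) (setIntegral_mono_set (hi j i) ?_ ?_)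
  · exact (ae_restrict_iff' (hm i j)).2 (.of_forall fun x hx => h0 x (T_image_subset b h hx))
  · exact LE.le.eventuallyLE fun x hx => subset_T_image b h hx.1 hx.2
  · exact (ae_restrict_iff' (hm j i)).2
      (.of_forall fun x hx => h0 x (T_image_subset b h.symm hx))
  · exact LE.le.eventuallyLE fun x hx =>
      subset_T_image b h.symm hx.1 (le_of_lt (not_le.1 hx.2))

/-- Mass matrix. -/
noncomputable def M (b : AffineBasis (Fin (d + 1)) ℝ (Fin d → ℝ)) (i j : Fin (d + 1)) : ℝ :=
  ∫ x in S b, b.coord i x * b.coord j x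

lemma M_int (b : AffineBasis (Fin (d + 1)) ℝ (Fin d → ℝ)) (i j : Fin (d + 1)) :
    IntegrableOn (fun x => b.coord i x * b.coord j x) (S b) :=
  ((cont_coord b i).mul (cont_coord b j)).continuousOn.integrableOn_compact (compact_S b)

lemma int_quad (b : AffineBasis (Fin (d + 1)) ℝ (Fin d → ℝ)) (i j : Fin (d + 1)) (r s t : ℝ) :
    ∫ x in S b, (r * (b.coord i x * b.coord i x) + s * (b.coord i x * b.coord j x)
      + t * (b.coord j x * b.coord j x)) = r * M b i i + s * M b i j + t * M b j j := by
  have h1 := (M_int b i i).const_mul r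
  have h2 := (M_int b i j).const_mul s
  have h3 := (M_int b j j).const_mul t
  have h12 : IntegrableOn (fun x => r * (b.coord i x * b.coord i x) +
      s * (b.coord i x * b.coord j x)) (S b) := h1.add h2
  rw [integral_add h12 h3, integral_add h1 h2, integral_const_mul, integral_const_mul,
    integral_const_mul]
  rfl

lemma M_off (b : AffineBasis (Fin (d + 1)) ℝ (Fin d → ℝ)) {i j : Fin (d + 1)}
    (h : i ≠ j) : M b i j ≤ (M b i i + M b j j) / 4 := by
  have := key b h (fun x => b.coord i x * b.coord j x) ((cont_coord b i).mul (cont_coord b j))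
    fun x hx => mul_nonneg (hx i) (hx j)
  simp only [coord_T_left b h, coord_T_right b h, coord_T_left b h.symm,
    coord_T_right b h.symm] at this
  have e1 := int_quad b i j 0 (1 / 2) (1 / 4)
  have e2 := int_quad b i j (1 / 4) (1 / 2) 0
  have f1 : ∀ x, (b.coord i x + b.coord j x / 2) * (b.coord j x / 2) =
    (0 * (b.coord i x * b.coord i x) + (1 / 2) * (b.coord i x * b.coord j x)
      + (1 / 4) * (b.coord j x * b.coord j x)) := fun x => by ring
  have f2 : ∀ x, (b.coord i x / 2) * (b.coord j x + b.coord i x / 2) =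
    ((1 / 4) * (b.coord i x * b.coord i x) + (1 / 2) * (b.coord i x * b.coord j x)
      + 0 * (b.coord j x * b.coord j x)) := fun x => by ring
  simp only [f1, f2] at this
  rw [e1, e2] at this
  change M b i j ≤ _ at this
  linarith

lemma M_diag (b : AffineBasis (Fin (d + 1)) ℝ (Fin d → ℝ)) {i j : Fin (d + 1)}
    (h : i ≠ j) : 3 * M b i i ≤ 4 * M b i j + M b j j := by
  have := key b h (fun x => b.coord i x * b.coord i x) ((cont_coord b i).mul (cont_coord b i))
    fun x hx => mul_nonneg (hx i) (hx i)
  simp only [coord_T_left b h, coord_T_right b h.symm] at this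
  have e1 := int_quad b i j 1 1 (1 / 4)
  have e2 := int_quad b i j (1 / 4) 0 0
  have f1 : ∀ x, (b.coord i x + b.coord j x / 2) * (b.coord i x + b.coord j x / 2) =
    (1 * (b.coord i x * b.coord i x) + 1 * (b.coord i x * b.coord j x)
      + (1 / 4) * (b.coord j x * b.coord j x)) := fun x => by ring
  have f2 : ∀ x, (b.coord i x / 2) * (b.coord i x / 2) =
    ((1 / 4) * (b.coord i x * b.coord i x) + 0 * (b.coord i x * b.coord j x)
      + 0 * (b.coord j x * b.coord j x)) := fun x => by ring
  simp only [f1, f2] at this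
  rw [e1, e2] at this
  change M b i i ≤ _ at this
  linarith

lemma M_comm (b : AffineBasis (Fin (d + 1)) ℝ (Fin d → ℝ)) (i j : Fin (d + 1)) :
    M b i j = M b j i := by simp only [M, mul_comm]

lemma M_diag_eq (b : AffineBasis (Fin (d + 1)) ℝ (Fin d → ℝ)) (i j : Fin (d + 1)) :
    M b i i = M b j j := by
  by_cases h : i = j
  · rw [h]
  have h1 := M_off b h
  have h2 := M_diag b h
  have h3 := M_diag b (Ne.symm h)
  rw [M_comm b j i] at h3
  linarith

lemma M_eq (b : AffineBasis (Fin (d + 1)) ℝ (Fin d → ℝ)) (i j : Fin (d + 1)) :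
    M b i j = M b 0 0 / 2 * (1 + if i = j then 1 else 0) := by
  by_cases h : i = j
  · subst h; rw [M_diag_eq b i 0]; simp; ring
  have h1 := M_off b h
  have h2 := M_diag b h
  have h3 := M_diag_eq b i 0
  have h4 := M_diag_eq b j 0
  simp only [h, if_false]
  linarith

lemma int_sq (b : AffineBasis (Fin (d + 1)) ℝ (Fin d → ℝ)) (q : Fin (d + 1) → ℝ) :
    ∫ x in S b, (∑ i, q i * b.coord i x) ^ 2 =
      M b 0 0 / 2 * ((∑ i, q i) ^ 2 + ∑ i, q i ^ 2) := by
  have e : ∀ x, (∑ i, q i * b.coord i x) ^ 2 =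
      ∑ i, ∑ j, (q i * q j) * (b.coord i x * b.coord j x) := fun x => by
    rw [sq, Finset.sum_mul_sum]
    exact Finset.sum_congr rfl fun i _ => Finset.sum_congr rfl fun j _ => by ring
  simp only [e]
  rw [integral_finsetSum _ fun i _ => integrable_finsetSum _ fun j _ => (M_int b i j).const_mul _]
  have : ∀ i, ∫ x in S b, ∑ j, (q i * q j) * (b.coord i x * b.coord j x) =
      M b 0 0 / 2 * (q i * (∑ j, q j) + q i ^ 2) := fun i => by
    rw [integral_finsetSum _ fun j _ => (M_int b i j).const_mul _]
    simp only [integral_const_mul]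
    change ∑ j, q i * q j * M b i j = _
    simp only [M_eq b i, mul_add, mul_one, mul_ite, mul_zero, Finset.sum_add_distrib,
      Finset.sum_ite_eq, Finset.mem_univ, if_true, Finset.mul_sum]
    congr 1
    · exact Finset.sum_congr rfl fun j _ => by ring
    · ring
  simp only [this]
  rw [← Finset.mul_sum, Finset.sum_add_distrib, ← Finset.sum_mul, sq (∑ i, q i)]

lemma vol_eq (b : AffineBasis (Fin (d + 1)) ℝ (Fin d → ℝ)) :
    (volume (S b)).toReal = M b 0 0 / 2 * ((d + 1) * (d + 2)) := by
  have := int_sq b fun _ => 1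
  simp only [one_mul, b.sum_coord_apply_eq_one] at this
  simp [Measure.real] at this
  rw [this]; ring

lemma affine_eq (b : AffineBasis (Fin (d + 1)) ℝ (Fin d → ℝ)) (p : (Fin d → ℝ) →ᵃ[ℝ] ℝ)
    (x : Fin d → ℝ) : p x = ∑ i, p (b i) * b.coord i x := by
  conv_lhs => rw [← b.affineCombination_coord_eq_self x]
  rw [Finset.map_affineCombination _ _ _ (b.sum_coord_apply_eq_one x),
    Finset.affineCombination_eq_linear_combination _ _ _ (b.sum_coord_apply_eq_one x)]
  simp [mul_comm]

end SimplexAux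

/-- For an affine function `p` on a nondegenerate `d`-simplex `τ` with vertex
values `p(v i)`, it holds that
`|τ|/((d+1)(d+2)) Σ p(v i)² ≤ ∫_τ p² ≤ |τ|/(d+1) Σ p(v i)²`. -/
theorem affine_simplex_L2_bounds (d : ℕ)
    (v : Fin (d + 1) → (Fin d → ℝ)) (hv : AffineIndependent ℝ v)
    (τ : Set (Fin d → ℝ)) (hτ : τ = convexHull ℝ (Set.range v))
    (p : (Fin d → ℝ) →ᵃ[ℝ] ℝ)
    (volτ : ℝ) (hvol : volτ = (volume τ).toReal) :
    volτ / ((d + 1) * (d + 2)) * ∑ i, (p (v i)) ^ 2 ≤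
        (∫ x in τ, (p x) ^ 2) ∧
      (∫ x in τ, (p x) ^ 2) ≤ volτ / (d + 1) * ∑ i, (p (v i)) ^ 2 := by
  let b : AffineBasis (Fin (d + 1)) ℝ (Fin d → ℝ) :=
    ⟨v, hv, hv.affineSpan_eq_top_iff_card_eq_finrank_add_one.2 (by simp)⟩
  have hS : τ = SimplexAux.S b := by rw [hτ, SimplexAux.S_eq]; rfl
  have hV := SimplexAux.vol_eq b
  rw [← hS, ← hvol] at hV
  have hI : ∫ x in τ, (p x) ^ 2 = SimplexAux.M b 0 0 / 2 *
      ((∑ i, p (v i)) ^ 2 + ∑ i, p (v i) ^ 2) := by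
    rw [hS, ← SimplexAux.int_sq b fun i => p (v i)]
    exact congrArg (fun f => ∫ x in SimplexAux.S b, f x)
      (funext fun x => congrArg (· ^ 2) (SimplexAux.affine_eq b p x))
  have hM : 0 ≤ SimplexAux.M b 0 0 := integral_nonneg fun x => mul_self_nonneg _
  have hd1 : (d : ℝ) + 1 ≠ 0 := by positivity
  have hd2 : (d : ℝ) + 2 ≠ 0 := by positivity
  rw [hI, hV]
  have hcs : (∑ i, p (v i)) ^ 2 ≤ (d + 1) * ∑ i, p (v i) ^ 2 := by
    simpa using sq_sum_le_card_mul_sum_sq (s := Finset.univ) (f := fun i => p (v i))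
  rw [mul_div_cancel_right₀ _ (mul_ne_zero hd1 hd2),
    show SimplexAux.M b 0 0 / 2 * (((d : ℝ) + 1) * (d + 2)) / (d + 1) =
      SimplexAux.M b 0 0 / 2 * (d + 2) by field_simp]
  constructor
  · exact mul_le_mul_of_nonneg_left (by linarith [sq_nonneg (∑ i, p (v i))]) (by positivity)
  · rw [mul_assoc]
    exact mul_le_mul_of_nonneg_left (by linarith) (by positivity)
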